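/- Let A, C, Q, B be n×n real matrices with C and Q symmetric, let τ > 0, and suppose Q·Bᵀ + B·Q = −(A·C + C·Aᵀ) (the generalized fluctuation–dissipation relation). Define K₁ := A·C + Q·Bᵀ and K₂ := A·K₁ − τ⁻¹·Q·Bᵀ, and suppose K₂ is symmetric. Then K₂ = ½·( A·(K₁ + τ⁻¹·C) + (K₁ᵀ + τ⁻¹·C)·Aᵀ ). -/

import Mathlib

open Matrix

/-- Colored-LIM second-derivative identity: with `C`, `Q` symmetric, `τ > 0`, the generalized
fluctuation–dissipation relation `Q * Bᵀ + B * Q = -(A * C + C * Aᵀ)`, `K₁ := A * C + Q * Bᵀ`,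
`K₂ := A * K₁ - τ⁻¹ • (Q * Bᵀ)`, and `K₂` symmetric, one has
`K₂ = ½ • (A * (K₁ + τ⁻¹ • C) + (K₁ᵀ + τ⁻¹ • C) * Aᵀ)`. -/
theorem second_derivative_identity {n : ℕ} (A C Q B : Matrix (Fin n) (Fin n) ℝ) (τ : ℝ)
    (hτ : 0 < τ) (hC : Cᵀ = C) (hQ : Qᵀ = Q)
    (hfdr : Q * Bᵀ + B * Q = -(A * C + C * Aᵀ))
    (K₁ K₂ : Matrix (Fin n) (Fin n) ℝ)
    (hK₁ : K₁ = A * C + Q * Bᵀ)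
    (hK₂ : K₂ = A * K₁ - τ⁻¹ • (Q * Bᵀ))
    (hK₂symm : K₂ᵀ = K₂) :
    K₂ = (1 / 2 : ℝ) • (A * (K₁ + τ⁻¹ • C) + (K₁ᵀ + τ⁻¹ • C) * Aᵀ) := by
  have h1 : K₂ᵀ = K₁ᵀ * Aᵀ - τ⁻¹ • (B * Q) := by
    rw [hK₂]
    simp [Matrix.transpose_sub, Matrix.transpose_smul, Matrix.transpose_mul, hQ]
  have h2 : K₂ + K₂ = A * (K₁ + τ⁻¹ • C) + (K₁ᵀ + τ⁻¹ • C) * Aᵀ := by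
    have h3 : A * C + C * Aᵀ = -(Q * Bᵀ + B * Q) := by rw [hfdr, neg_neg]
    calc K₂ + K₂ = K₂ + K₂ᵀ := by rw [hK₂symm]
      _ = A * K₁ + K₁ᵀ * Aᵀ + τ⁻¹ • (-(Q * Bᵀ + B * Q)) := by
        rw [h1, hK₂, smul_neg, smul_add]
        abel
      _ = _ := by
        rw [← h3, Matrix.mul_add, Matrix.add_mul, Matrix.mul_smul, Matrix.smul_mul, smul_add]
        abel
  rw [← h2, ← two_smul ℝ K₂, smul_smul]
  norm_num
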